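/- arXiv:1810.06607 — 3 statements merged into one kernel-verified Lean document; each statement's English description precedes it below -/
import Mathlib

section
/- For (a,b,c) ∈ ℂ³ define the quartic f_{(a,b,c)}(x,y,z) = 3a(b²−c²)·x²yz + 3b(c²−a²)·xy²z + 3c(a²−b²)·xyz² + a³·yz(y²−z²) − b³·xz(x²−z²) + c³·xy(x²−y²). Then: (i) f_{(a,b,c)} vanishes at all nine points P₁=(1,0,0), P₂=(0,1,0), P₃=(0,0,1), P₄=(1,1,0), P₅=(1,−1,0), P₆=(1,0,1), P₇=(1,0,−1), P₈=(0,1,1), P₉=(0,1,−1) of the B₃ configuration; (ii) f_{(a,b,c)} and all of its partial derivatives of order ≤ 2 with respect to x, y, z vanish at the point (a,b,c), i.e. f_{(a,b,c)} has a point of multiplicity at least 3 at (a,b,c); and (iii) if (a,b,c) ≠ (0,0,0) then f_{(a,b,c)} ≠ 0. Hence for every point P = (a:b:c) ∈ ℙ² the B₃ configuration admits a nonzero quartic through Z with a triple point at P (an unexpected quartic). -/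
open MvPolynomial

/-- The nine points of the B₃ configuration in ℂ³. -/
noncomputable def B3points : Fin 9 → (Fin 3 → ℂ) :=
  ![![1, 0, 0], ![0, 1, 0], ![0, 0, 1],
    ![1, 1, 0], ![1, -1, 0], ![1, 0, 1],
    ![1, 0, -1], ![0, 1, 1], ![0, 1, -1]]

/-- The unexpected quartic of the B₃ configuration associated to (a,b,c). -/
noncomputable def unexpQuartic (a b c : ℂ) : MvPolynomial (Fin 3) ℂ :=
  C (3 * a * (b ^ 2 - c ^ 2)) * (X 0 ^ 2 * X 1 * X 2)
  + C (3 * b * (c ^ 2 - a ^ 2)) * (X 0 * X 1 ^ 2 * X 2)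
  + C (3 * c * (a ^ 2 - b ^ 2)) * (X 0 * X 1 * X 2 ^ 2)
  + C (a ^ 3) * (X 1 * X 2 * (X 1 ^ 2 - X 2 ^ 2))
  - C (b ^ 3) * (X 0 * X 2 * (X 0 ^ 2 - X 2 ^ 2))
  + C (c ^ 3) * (X 0 * X 1 * (X 0 ^ 2 - X 1 ^ 2))

theorem pderiv_ofNat {σ R : Type*} [CommSemiring R] (i : σ) (n : ℕ) [n.AtLeastTwo] :
    pderiv i (ofNat(n) : MvPolynomial σ R) = 0 :=
  (pderiv i).map_natCast n

/-- The quartic f_{(a,b,c)} vanishes at all nine points of the B₃ configuration,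
has a point of multiplicity at least 3 at (a,b,c), and is nonzero whenever
(a,b,c) ≠ (0,0,0): every point of ℙ² admits an unexpected quartic through Z. -/
theorem unexpected_quartic_B3 (a b c : ℂ) :
    (∀ i : Fin 9, eval (B3points i) (unexpQuartic a b c) = 0) ∧
    (eval ![a, b, c] (unexpQuartic a b c) = 0 ∧
      (∀ i : Fin 3, eval ![a, b, c] (pderiv i (unexpQuartic a b c)) = 0) ∧
      (∀ i j : Fin 3,
        eval ![a, b, c] (pderiv i (pderiv j (unexpQuartic a b c))) = 0)) ∧
    ((a, b, c) ≠ (0, 0, 0) → unexpQuartic a b c ≠ 0) := by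
  refine ⟨fun i => ?_, ⟨?_, fun i => ?_, fun i j => ?_⟩, fun h hf => h ?_⟩
  · fin_cases i <;> simp [B3points, unexpQuartic]
  · simp [unexpQuartic]
    ring
  · fin_cases i <;> simp [unexpQuartic, pderiv_X, Derivation.leibniz_pow] <;> ring
  · fin_cases i <;> fin_cases j <;>
      simp [unexpQuartic, pderiv_X, Derivation.leibniz_pow, pderiv_ofNat] <;> ring
  · have ha := congrArg (eval ![0, 2, 1]) hf
    have hb := congrArg (eval ![2, 0, 1]) hf
    have hc := congrArg (eval ![2, 1, 0]) hf
    simp [unexpQuartic] at ha hb hc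
    norm_num at ha hb hc
    simp [ha, hb, hc]
end

section
/- Let q₁ = x²yz, q₂ = xy²z, q₃ = xyz², q₄ = xy(x²−y²), q₅ = xz(x²−z²), q₆ = yz(y²−z²) in ℂ[x,y,z], and let H(a,b,c) be the 6×6 matrix of all second-order partial derivatives of q₁,…,q₆ (columns indexed by the pairs (x,x),(y,y),(z,z),(x,y),(x,z),(y,z)) evaluated at (a,b,c). Then for every (a,b,c) ∈ ℂ³ with abc ≠ 0, the matrix H(a,b,c) has rank exactly 5. (Equivalently, at every smooth point of the B₃ surface the second osculating space has dimension 4 instead of the expected 5.) -/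
open MvPolynomial

/-- The six quartics x²yz, xy²z, xyz², xy(x²−y²), xz(x²−z²), yz(y²−z²). -/
noncomputable def B3quartics : Fin 6 → MvPolynomial (Fin 3) ℂ :=
  ![X 0 ^ 2 * X 1 * X 2,
    X 0 * X 1 ^ 2 * X 2,
    X 0 * X 1 * X 2 ^ 2,
    X 0 * X 1 * (X 0 ^ 2 - X 1 ^ 2),
    X 0 * X 2 * (X 0 ^ 2 - X 2 ^ 2),
    X 1 * X 2 * (X 1 ^ 2 - X 2 ^ 2)]

/-- The six unordered pairs of variables (x,x),(y,y),(z,z),(x,y),(x,z),(y,z). -/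
def varPairs : Fin 6 → Fin 3 × Fin 3 :=
  ![(0, 0), (1, 1), (2, 2), (0, 1), (0, 2), (1, 2)]

/-- The 6×6 matrix of all second-order partial derivatives of the six B₃
quartics, evaluated at a point of ℂ³. -/
noncomputable def B3Hessian (v : Fin 3 → ℂ) : Matrix (Fin 6) (Fin 6) ℂ :=
  Matrix.of fun i j =>
    eval v (pderiv (varPairs j).1 (pderiv (varPairs j).2 (B3quartics i)))


theorem B3Hessian_eq (a b c : ℂ) :
    B3Hessian ![a, b, c] =
      !![2 * b * c, 0, 0, 2 * a * c, 2 * a * b, a ^ 2;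
         0, 2 * a * c, 0, 2 * b * c, b ^ 2, 2 * a * b;
         0, 0, 2 * a * b, c ^ 2, 2 * b * c, 2 * a * c;
         6 * a * b, -6 * a * b, 0, 3 * a ^ 2 - 3 * b ^ 2, 0, 0;
         6 * a * c, 0, -6 * a * c, 0, 3 * a ^ 2 - 3 * c ^ 2, 0;
         0, 6 * b * c, -6 * b * c, 0, 0, 3 * b ^ 2 - 3 * c ^ 2] := by
  have pderiv_two (i : Fin 3) : pderiv i (2 : MvPolynomial (Fin 3) ℂ) = 0 :=
    pderiv_C (a := 2)
  ext i j
  fin_cases i <;> fin_cases j <;>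
    simp [B3Hessian, B3quartics, varPairs, Derivation.leibniz, Derivation.leibniz_pow,
      pderiv_X, pderiv_two] <;> ring

/-- A vector spanning the kernel of the B₃ Hessian at `(a, b, c)`. -/
def b3HessianKernelVector (a b c : ℂ) : Fin 6 → ℂ :=
  ![a ^ 2 * (a ^ 2 - 3 * b ^ 2 - 3 * c ^ 2),
    b ^ 2 * (b ^ 2 - 3 * a ^ 2 - 3 * c ^ 2),
    c ^ 2 * (c ^ 2 - 3 * a ^ 2 - 3 * b ^ 2),
    2 * a * b * (3 * c ^ 2 - a ^ 2 - b ^ 2),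
    2 * a * c * (3 * b ^ 2 - a ^ 2 - c ^ 2),
    2 * b * c * (3 * a ^ 2 - b ^ 2 - c ^ 2)]

theorem b3HessianKernelVector_ne_zero {a b c : ℂ} (ha : a ≠ 0) (hb : b ≠ 0) (hc : c ≠ 0) :
    b3HessianKernelVector a b c ≠ 0 := by
  intro h
  have h₃ := congrFun h 3
  have h₄ := congrFun h 4
  have h₅ := congrFun h 5
  simp [b3HessianKernelVector, ha, hb, hc] at h₃ h₄ h₅
  refine pow_ne_zero 2 hc ?_
  linear_combination (1 / 2) * h₃ + (1 / 4) * h₄ + (1 / 4) * h₅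

theorem B3Hessian_mulVec_kernelVector (a b c : ℂ) :
    (B3Hessian ![a, b, c]).mulVec (b3HessianKernelVector a b c) = 0 := by
  rw [B3Hessian_eq]
  ext i
  fin_cases i <;>
    simp [b3HessianKernelVector, Matrix.mulVec, dotProduct, Fin.sum_univ_succ] <;> ring

theorem exists_smul_kernelVector_of_B3Hessian_mulVec_eq_zero {a b c : ℂ}
    (ha : a ≠ 0) (hb : b ≠ 0) (hc : c ≠ 0) {u : Fin 6 → ℂ}
    (hu : (B3Hessian ![a, b, c]).mulVec u = 0) :
    ∃ t : ℂ, t • b3HessianKernelVector a b c = u := by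
  obtain ⟨w, rfl⟩ : ∃ w : Fin 6 → ℂ, ![a ^ 2 * w 0, b ^ 2 * w 1, c ^ 2 * w 2,
      a * b * w 3, a * c * w 4, b * c * w 5] = u := by
    refine ⟨![u 0 / a ^ 2, u 1 / b ^ 2, u 2 / c ^ 2, u 3 / (a * b), u 4 / (a * c),
      u 5 / (b * c)], ?_⟩
    ext i
    fin_cases i <;> simp <;> field_simp
  rw [B3Hessian_eq] at hu
  have e₀ := congrFun hu 0
  have e₁ := congrFun hu 1
  have e₂ := congrFun hu 2
  have e₃ := congrFun hu 3
  have e₄ := congrFun hu 4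
  simp [Matrix.mulVec, dotProduct, Fin.sum_univ_succ] at e₀ e₁ e₂ e₃ e₄
  have f₀ : 2 * w 0 + 2 * w 3 + 2 * w 4 + w 5 = 0 := by
    refine mul_left_cancel₀ (mul_ne_zero (mul_ne_zero (pow_ne_zero 2 ha) hb) hc) ?_
    linear_combination e₀
  have f₁ : 2 * w 1 + 2 * w 3 + w 4 + 2 * w 5 = 0 := by
    refine mul_left_cancel₀ (mul_ne_zero (mul_ne_zero (pow_ne_zero 2 hb) ha) hc) ?_
    linear_combination e₁
  have f₂ : 2 * w 2 + w 3 + 2 * w 4 + 2 * w 5 = 0 := by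
    refine mul_left_cancel₀ (mul_ne_zero (mul_ne_zero (pow_ne_zero 2 hc) ha) hb) ?_
    linear_combination e₂
  have f₃ : a ^ 2 * (w 3 + 2 * w 4 + w 5) = b ^ 2 * (w 3 + w 4 + 2 * w 5) := by
    refine mul_left_cancel₀ (mul_ne_zero ha hb) ?_
    linear_combination (-1 / 3) * e₃ + a * b * (a ^ 2 * f₀ - b ^ 2 * f₁)
  have f₄ : a ^ 2 * (2 * w 3 + w 4 + w 5) = c ^ 2 * (w 3 + w 4 + 2 * w 5) := by
    refine mul_left_cancel₀ (mul_ne_zero ha hc) ?_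
    linear_combination (-1 / 3) * e₄ + a * c * (a ^ 2 * f₀ - c ^ 2 * f₂)
  have g₃ : 4 * a ^ 2 * w 3 = (w 3 + w 4 + 2 * w 5) * (3 * c ^ 2 - a ^ 2 - b ^ 2) := by
    linear_combination 3 * f₄ - f₃
  have g₄ : 4 * a ^ 2 * w 4 = (w 3 + w 4 + 2 * w 5) * (3 * b ^ 2 - a ^ 2 - c ^ 2) := by
    linear_combination 3 * f₃ - f₄
  have g₅ : 4 * a ^ 2 * w 5 = (w 3 + w 4 + 2 * w 5) * (3 * a ^ 2 - b ^ 2 - c ^ 2) := by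
    linear_combination - f₃ - f₄
  refine ⟨(w 3 + w 4 + 2 * w 5) / (8 * a ^ 2), ?_⟩
  ext i
  fin_cases i <;> simp [b3HessianKernelVector] <;> field_simp
  · linear_combination -4 * a ^ 2 * f₀ + 2 * g₃ + 2 * g₄ + g₅
  · linear_combination -4 * a ^ 2 * f₁ + 2 * g₃ + g₄ + 2 * g₅
  · linear_combination -4 * a ^ 2 * f₂ + g₃ + 2 * g₄ + 2 * g₅
  · linear_combination -2 * g₃
  · linear_combination -2 * g₄
  · linear_combination -2 * g₅

/-- At every point (a,b,c) with abc ≠ 0 the matrix of second-order partials of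
the six B₃ quartics has rank exactly 5: at every smooth point of the B₃ surface
the second osculating space has dimension 4 instead of the expected 5. -/
theorem b3_hessian_rank_five (a b c : ℂ) (h : a * b * c ≠ 0) :
    (B3Hessian ![a, b, c]).rank = 5 := by
  obtain ⟨⟨ha, hb⟩, hc⟩ : (a ≠ 0 ∧ b ≠ 0) ∧ c ≠ 0 := by
    simpa only [mul_ne_zero_iff] using h
  have hker : LinearMap.ker (B3Hessian ![a, b, c]).mulVecLin =
      Submodule.span ℂ {b3HessianKernelVector a b c} := by
    ext u
    rw [LinearMap.mem_ker, Matrix.mulVecLin_apply, Submodule.mem_span_singleton]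
    constructor
    · exact exists_smul_kernelVector_of_B3Hessian_mulVec_eq_zero ha hb hc
    · rintro ⟨t, rfl⟩
      rw [Matrix.mulVec_smul, B3Hessian_mulVec_kernelVector, smul_zero]
  have hsum := LinearMap.finrank_range_add_finrank_ker (B3Hessian ![a, b, c]).mulVecLin
  rw [hker, finrank_span_singleton (b3HessianKernelVector_ne_zero ha hb hc),
    Module.finrank_fin_fun] at hsum
  rw [Matrix.rank]
  omega
end

section
/- Let ψ : ℂ³ → ℂ⁶ be given by ψ(x,y,z) = (x²yz, xy²z, xyz², xy(x²−y²), xz(x²−z²), yz(y²−z²)). Then the vanishing ideal in ℂ[u₀,u₁,u₂,u₃,u₄,u₅] of the image set {ψ(x,y,z) : (x,y,z) ∈ ℂ³} ⊆ ℂ⁶ (equivalently, the homogeneous ideal I(X_{B₃}) of the affine cone over the B₃ surface X_{B₃} ⊂ ℙ⁵) is generated by the four polynomials u₁² − u₂² − u₀u₅, u₀² − u₂² − u₁u₄, u₂u₃ − u₁u₄ + u₀u₅, and u₀u₁u₃ − u₀u₂u₄ + u₁u₂u₅ − u₃u₄u₅. -/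
open MvPolynomial

/-- The affine parametrization ψ of the (cone over the) B₃ surface. -/
noncomputable def psiB3 (x y z : ℂ) : Fin 6 → ℂ :=
  ![x ^ 2 * y * z, x * y ^ 2 * z, x * y * z ^ 2,
    x * y * (x ^ 2 - y ^ 2), x * z * (x ^ 2 - z ^ 2), y * z * (y ^ 2 - z ^ 2)]

namespace B3Surface

/-- The exponents of the monomials divisible by none of
`u₂u₃`, `u₁u₄`, `u₀u₅`, `u₃u₄u₅`. -/
def IsStandard (t : Fin 6 →₀ ℕ) : Prop :=
  (t 0 = 0 ∨ t 5 = 0) ∧ (t 1 = 0 ∨ t 4 = 0) ∧ (t 2 = 0 ∨ t 3 = 0) ∧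
    (t 3 = 0 ∨ t 4 = 0 ∨ t 5 = 0)

/-- The ideal generated by the four equations of the B₃ surface. -/
noncomputable def equations : Ideal (MvPolynomial (Fin 6) ℂ) :=
  Ideal.span
    ({X 1 ^ 2 - X 2 ^ 2 - X 0 * X 5,
      X 0 ^ 2 - X 2 ^ 2 - X 1 * X 4,
      X 2 * X 3 - X 1 * X 4 + X 0 * X 5,
      X 0 * X 1 * X 3 - X 0 * X 2 * X 4 + X 1 * X 2 * X 5 - X 3 * X 4 * X 5} :
      Set (MvPolynomial (Fin 6) ℂ))

theorem eval_psiB3_of_mem_equations {F : MvPolynomial (Fin 6) ℂ} (hF : F ∈ equations)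
    (x y z : ℂ) : eval (psiB3 x y z) F = 0 := by
  suffices h : equations ≤ RingHom.ker (eval (psiB3 x y z)) from h hF
  refine Ideal.span_le.2 ?_
  rintro p (rfl | rfl | rfl | rfl) <;>
  · simp only [SetLike.mem_coe, RingHom.mem_ker, map_sub, map_add, map_mul, map_pow, eval_X,
      psiB3]
    simp
    ring

theorem X_zero_mul_X_five_sub_mem_equations :
    (X 0 * X 5 - (X 1 ^ 2 - X 2 ^ 2) : MvPolynomial (Fin 6) ℂ) ∈ equations := by
  have h : (X 1 ^ 2 - X 2 ^ 2 - X 0 * X 5 : MvPolynomial (Fin 6) ℂ) ∈ equations :=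
    Ideal.subset_span (by simp)
  convert equations.neg_mem h using 1
  ring

theorem X_one_mul_X_four_sub_mem_equations :
    (X 1 * X 4 - (X 0 ^ 2 - X 2 ^ 2) : MvPolynomial (Fin 6) ℂ) ∈ equations := by
  have h : (X 0 ^ 2 - X 2 ^ 2 - X 1 * X 4 : MvPolynomial (Fin 6) ℂ) ∈ equations :=
    Ideal.subset_span (by simp)
  convert equations.neg_mem h using 1
  ring

theorem X_two_mul_X_three_sub_mem_equations :
    (X 2 * X 3 - (X 0 ^ 2 - X 1 ^ 2) : MvPolynomial (Fin 6) ℂ) ∈ equations := by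
  have h : (X 2 * X 3 - X 1 * X 4 + X 0 * X 5 : MvPolynomial (Fin 6) ℂ) ∈ equations :=
    Ideal.subset_span (by simp)
  convert equations.sub_mem (equations.add_mem h X_one_mul_X_four_sub_mem_equations)
    X_zero_mul_X_five_sub_mem_equations using 1
  ring

theorem cubic_mem_equations :
    (X 3 * X 4 * X 5 - (X 0 * X 1 * X 3 - X 0 * X 2 * X 4 + X 1 * X 2 * X 5) :
      MvPolynomial (Fin 6) ℂ) ∈ equations := by
  have h : (X 0 * X 1 * X 3 - X 0 * X 2 * X 4 + X 1 * X 2 * X 5 - X 3 * X 4 * X 5 :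
      MvPolynomial (Fin 6) ℂ) ∈ equations := Ideal.subset_span (by simp)
  convert equations.neg_mem h using 1
  ring

/-- The polynomials congruent to a combination of standard monomials modulo the equations. -/
noncomputable def reducible : Submodule ℂ (MvPolynomial (Fin 6) ℂ) :=
  equations.restrictScalars ℂ ⊔ restrictSupport ℂ {t | IsStandard t}

/-- Rewriting a monomial by an equation whose leading term `X ^ e` divides it. -/
theorem monomial_mem_reducible_of_le {t e : Fin 6 →₀ ℕ} (het : e ≤ t)
    {r : MvPolynomial (Fin 6) ℂ} (hr : monomial e 1 - r ∈ equations)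
    (h : monomial (t - e) 1 * r ∈ reducible) : monomial t 1 ∈ reducible := by
  have h₁ : monomial (t - e) 1 * (monomial e 1 - r) ∈ reducible :=
    Submodule.mem_sup_left (equations.mul_mem_left _ hr)
  convert reducible.add_mem h₁ h using 1
  rw [mul_sub, monomial_mul, tsub_add_cancel_of_le het]
  simp

theorem monomial_mem_reducible (n : ℕ) :
    ∀ t : Fin 6 →₀ ℕ, t 3 + t 4 + t 5 = n → monomial t 1 ∈ reducible := by
  induction n using Nat.strong_induction_on with
  | _ n ih =>
  intro t ht
  by_cases hs : IsStandard t
  · exact Submodule.mem_sup_right (by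
      rw [mem_restrictSupport_iff]
      exact fun s hs' => by
        rw [Finset.mem_coe, support_monomial, if_neg one_ne_zero, Finset.mem_singleton] at hs'
        exact hs' ▸ hs)
  have ih' : ∀ s : Fin 6 →₀ ℕ, s 3 + s 4 + s 5 < t 3 + t 4 + t 5 → monomial s 1 ∈ reducible :=
    fun s hs => ih _ (ht ▸ hs) s rfl
  have le_iff (e : Fin 6 →₀ ℕ) : e ≤ t ↔ e 0 ≤ t 0 ∧ e 1 ≤ t 1 ∧ e 2 ≤ t 2 ∧ e 3 ≤ t 3 ∧
      e 4 ≤ t 4 ∧ e 5 ≤ t 5 := by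
    simp [Finsupp.le_def, Fin.forall_fin_succ]
  have hcases : (1 ≤ t 0 ∧ 1 ≤ t 5) ∨ (1 ≤ t 1 ∧ 1 ≤ t 4) ∨ (1 ≤ t 2 ∧ 1 ≤ t 3) ∨
      (1 ≤ t 3 ∧ 1 ≤ t 4 ∧ 1 ≤ t 5) := by
    unfold IsStandard at hs
    omega
  rcases hcases with h | h | h | h
  · refine monomial_mem_reducible_of_le (e := .single 0 1 + .single 5 1) ?_
      (r := X 1 ^ 2 - X 2 ^ 2) ?_ ?_
    · rw [le_iff]; simp; omega
    · simpa [X, monomial_mul, monomial_pow] using X_zero_mul_X_five_sub_mem_equations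
    · simp only [X, monomial_mul, monomial_pow, mul_sub, mul_one, one_pow]
      refine reducible.sub_mem (ih' _ ?_) (ih' _ ?_) <;> simp <;> omega
  · refine monomial_mem_reducible_of_le (e := .single 1 1 + .single 4 1) ?_
      (r := X 0 ^ 2 - X 2 ^ 2) ?_ ?_
    · rw [le_iff]; simp; omega
    · simpa [X, monomial_mul, monomial_pow] using X_one_mul_X_four_sub_mem_equations
    · simp only [X, monomial_mul, monomial_pow, mul_sub, mul_one, one_pow]
      refine reducible.sub_mem (ih' _ ?_) (ih' _ ?_) <;> simp <;> omega
  · refine monomial_mem_reducible_of_le (e := .single 2 1 + .single 3 1) ?_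
      (r := X 0 ^ 2 - X 1 ^ 2) ?_ ?_
    · rw [le_iff]; simp; omega
    · simpa [X, monomial_mul, monomial_pow] using X_two_mul_X_three_sub_mem_equations
    · simp only [X, monomial_mul, monomial_pow, mul_sub, mul_one, one_pow]
      refine reducible.sub_mem (ih' _ ?_) (ih' _ ?_) <;> simp <;> omega
  · refine monomial_mem_reducible_of_le (e := .single 3 1 + .single 4 1 + .single 5 1) ?_
      (r := X 0 * X 1 * X 3 - X 0 * X 2 * X 4 + X 1 * X 2 * X 5) ?_ ?_
    · rw [le_iff]; simp; omega
    · simpa [X, monomial_mul, monomial_pow] using cubic_mem_equations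
    · simp only [X, monomial_mul, mul_sub, mul_add, mul_one]
      refine reducible.add_mem (reducible.sub_mem (ih' _ ?_) (ih' _ ?_)) (ih' _ ?_) <;>
        simp <;> omega

theorem mem_reducible (F : MvPolynomial (Fin 6) ℂ) : F ∈ reducible := by
  rw [F.as_sum]
  refine reducible.sum_mem fun t _ => ?_
  simpa [smul_monomial] using
    reducible.smul_mem (coeff t F) (monomial_mem_reducible _ t rfl)

/-- Distinct monomials in two variables are linearly independent as functions on the complement
of the curve `uv(u² - v²) = 0`. -/
theorem coeff_eq_zero_of_sum_monomials_eq_zero {ι : Type*} (s : Finset ι) (w : ι → ℂ)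
    (p q : ι → ℕ) (hinj : ∀ t ∈ s, ∀ t' ∈ s, p t = p t' → q t = q t' → t = t')
    (h : ∀ u v : ℂ, u ≠ 0 → v ≠ 0 → u ^ 2 - v ^ 2 ≠ 0 → ∑ t ∈ s, w t * (u ^ p t * v ^ q t) = 0) :
    ∀ t ∈ s, w t = 0 := by
  set P : MvPolynomial (Fin 2) ℂ :=
    ∑ t ∈ s, monomial (Finsupp.single 0 (p t) + Finsupp.single 1 (q t)) (w t) with hP
  have hPe (x : Fin 2 → ℂ) : eval x P = ∑ t ∈ s, w t * (x 0 ^ p t * x 1 ^ q t) := by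
    rw [hP, map_sum]
    refine Finset.sum_congr rfl fun t _ => ?_
    rw [eval_monomial, Finsupp.prod_add_index' (by simp) (by simp [pow_add])]
    simp
  have hQ : X 0 * X 1 * (X 0 ^ 2 - X 1 ^ 2) * P = 0 := by
    refine MvPolynomial.funext fun x => ?_
    simp only [map_mul, map_sub, map_pow, eval_X, map_zero]
    by_cases hx : x 0 * x 1 * (x 0 ^ 2 - x 1 ^ 2) = 0
    · rw [hx, zero_mul]
    · have hx' : (x 0 ≠ 0 ∧ x 1 ≠ 0) ∧ x 0 ^ 2 - x 1 ^ 2 ≠ 0 := by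
        simpa only [mul_ne_zero_iff] using (show _ ≠ _ from hx)
      rw [hPe, h _ _ hx'.1.1 hx'.1.2 hx'.2, mul_zero]
  have hne : (X 0 * X 1 * (X 0 ^ 2 - X 1 ^ 2) : MvPolynomial (Fin 2) ℂ) ≠ 0 := fun h0 => by
    have := congrArg (eval ![1, 2]) h0
    norm_num at this
  have hP0 : P = 0 := (mul_eq_zero.1 hQ).resolve_left hne
  intro t ht
  have hc : coeff (Finsupp.single 0 (p t) + Finsupp.single 1 (q t)) P = w t := by
    rw [hP, coeff_sum, Finset.sum_eq_single t]
    · simp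
    · intro t' ht' hne'
      rw [coeff_monomial, if_neg]
      intro he
      have h0 := DFunLike.congr_fun he 0
      have h1 := DFunLike.congr_fun he 1
      simp at h0 h1
      exact hne' (hinj _ ht' _ ht h0 h1)
    · exact fun h => absurd ht h
  rw [← hc, hP0, coeff_zero]

/-- In a relation between standard monomials in `a, b, c` and `(a² - b²) / c`, `(a² - c²) / b`,
`(b² - c²) / a`, the monomials with a pole along `c = 0` do not occur. -/
theorem coeff_eq_zero_of_pole {ι : Type*} (s : Finset ι) (w : ι → ℂ) (i j k l m n : ι → ℕ)
    (hin : ∀ t ∈ s, i t = 0 ∨ n t = 0) (hjm : ∀ t ∈ s, j t = 0 ∨ m t = 0)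
    (hkl : ∀ t ∈ s, k t = 0 ∨ l t = 0) (hlmn : ∀ t ∈ s, l t = 0 ∨ m t = 0 ∨ n t = 0)
    (hinj : ∀ t ∈ s, ∀ t' ∈ s, i t = i t' → j t = j t' → k t = k t' → l t = l t' → m t = m t' →
      n t = n t' → t = t')
    (h : ∀ a b c : ℂ, a ≠ 0 → b ≠ 0 → c ≠ 0 →
      ∑ t ∈ s, w t * (a ^ i t * b ^ j t * c ^ k t * ((a ^ 2 - b ^ 2) / c) ^ l t *
        ((a ^ 2 - c ^ 2) / b) ^ m t * ((b ^ 2 - c ^ 2) / a) ^ n t) = 0) :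
    ∀ t ∈ s, w t ≠ 0 → l t = 0 := by
  classical
  by_contra! hcon
  obtain ⟨t₁, ht₁, hw₁, hl₁⟩ := hcon
  obtain ⟨t₀, ht₀, hmax⟩ := (s.filter (w · ≠ 0)).exists_max_image l
    ⟨t₁, Finset.mem_filter.2 ⟨ht₁, hw₁⟩⟩
  have hK : l t₀ ≠ 0 := by
    have := hmax t₁ (Finset.mem_filter.2 ⟨ht₁, hw₁⟩)
    omega
  have hle : ∀ t ∈ s, w t ≠ 0 → l t ≤ l t₀ := fun t ht hw =>
    hmax t (Finset.mem_filter.2 ⟨ht, hw⟩)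
  have hlim (a b : ℂ) (ha : a ≠ 0) (hb : b ≠ 0) :
      ∑ t ∈ s, w t * (a ^ i t * b ^ j t * 0 ^ (l t₀ - l t + k t) * (a ^ 2 - b ^ 2) ^ l t *
        (a ^ 2 / b) ^ m t * (b ^ 2 / a) ^ n t) = 0 := by
    have hfun : (fun c : ℂ => ∑ t ∈ s, w t * (a ^ i t * b ^ j t * c ^ (l t₀ - l t + k t) *
        (a ^ 2 - b ^ 2) ^ l t * ((a ^ 2 - c ^ 2) / b) ^ m t * ((b ^ 2 - c ^ 2) / a) ^ n t)) =
        fun _ => 0 := by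
      refine Continuous.ext_on (dense_compl_singleton (0 : ℂ)) (by fun_prop) (by fun_prop) ?_
      intro c hc
      have hc : c ≠ 0 := hc
      rw [← mul_zero (c ^ l t₀), ← h a b c ha hb hc, Finset.mul_sum]
      refine Finset.sum_congr rfl fun t ht => ?_
      by_cases hw : w t = 0
      · simp [hw]
      · rw [div_pow (a ^ 2 - b ^ 2) c, ← Nat.sub_add_cancel (hle t ht hw)]
        simp only [Nat.add_sub_cancel, pow_add]
        field_simp
    simpa using congrFun hfun 0
  refine (Finset.mem_filter.1 ht₀).2 (coeff_eq_zero_of_sum_monomials_eq_zero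
    (s.filter fun t => l t = l t₀) w (fun t => 2 * i t + j t + 3 * m t)
    (fun t => i t + 2 * j t + 3 * n t) ?_ ?_ t₀
    (Finset.mem_filter.2 ⟨(Finset.mem_filter.1 ht₀).1, rfl⟩))
  · intro t ht t' ht' hp hq
    rw [Finset.mem_filter] at ht ht'
    have h₁ := hin t ht.1
    have h₂ := hjm t ht.1
    have h₃ := hkl t ht.1
    have h₄ := hlmn t ht.1
    have h₁' := hin t' ht'.1
    have h₂' := hjm t' ht'.1
    have h₃' := hkl t' ht'.1
    have h₄' := hlmn t' ht'.1
    have h₅ := ht.2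
    have h₅' := ht'.2
    apply hinj t ht.1 t' ht'.1 <;> omega
  · intro u v hu hv huv
    have hne : ((u ^ 2 * v) ^ 2 - (u * v ^ 2) ^ 2) ^ l t₀ ≠ 0 := by
      refine pow_ne_zero _ ?_
      rw [show (u ^ 2 * v) ^ 2 - (u * v ^ 2) ^ 2 = u ^ 2 * v ^ 2 * (u ^ 2 - v ^ 2) by ring]
      positivity
    refine (mul_eq_zero.1 ?_).resolve_left hne
    rw [← hlim (u ^ 2 * v) (u * v ^ 2) (by positivity) (by positivity), Finset.mul_sum,
      Finset.sum_filter]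
    refine Finset.sum_congr rfl fun t ht => ?_
    have he : (u ^ 2 * v) ^ 2 / (u * v ^ 2) = u ^ 3 := by field_simp
    have hf : (u * v ^ 2) ^ 2 / (u ^ 2 * v) = v ^ 3 := by field_simp
    rw [he, hf]
    split_ifs with hl
    · have hk : k t = 0 := (hkl t ht).resolve_right (hl ▸ hK)
      rw [hl, hk]
      simp only [Nat.sub_self, add_zero, pow_zero]
      ring
    · by_cases hw : w t = 0
      · simp [hw]
      · have := hle t ht hw
        rw [zero_pow (by omega)]
        simp

/-- Up to scaling, the image of `psiB3` contains the graph of the three rational functions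
`(a² - b²) / c`, `(a² - c²) / b`, `(b² - c²) / a`. -/
theorem exists_psiB3_eq {a b c : ℂ} (ha : a ≠ 0) (hb : b ≠ 0) (hc : c ≠ 0) :
    ∃ x y z, psiB3 x y z =
      ![a, b, c, (a ^ 2 - b ^ 2) / c, (a ^ 2 - c ^ 2) / b, (b ^ 2 - c ^ 2) / a] := by
  obtain ⟨r, hr⟩ := IsAlgClosed.exists_pow_nat_eq (a * b * c)⁻¹ (n := 4) (by norm_num)
  have hr' : r ^ 4 * (a * b * c) = 1 := by rw [hr]; field_simp
  refine ⟨a * r, b * r, c * r, ?_⟩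
  unfold psiB3
  congr 1
  · linear_combination a * hr'
  congr 1
  · linear_combination b * hr'
  congr 1
  · linear_combination c * hr'
  congr 1
  · rw [eq_div_iff hc]
    linear_combination (a ^ 2 - b ^ 2) * hr'
  congr 1
  · rw [eq_div_iff hb]
    linear_combination (a ^ 2 - c ^ 2) * hr'
  congr 1
  · rw [eq_div_iff ha]
    linear_combination (b ^ 2 - c ^ 2) * hr'

theorem eq_zero_of_isStandard {G : MvPolynomial (Fin 6) ℂ} (hG : ∀ t ∈ G.support, IsStandard t)
    (h : ∀ x y z, eval (psiB3 x y z) G = 0) : G = 0 := by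
  have hgraph (a b c : ℂ) (ha : a ≠ 0) (hb : b ≠ 0) (hc : c ≠ 0) : eval
      ![a, b, c, (a ^ 2 - b ^ 2) / c, (a ^ 2 - c ^ 2) / b, (b ^ 2 - c ^ 2) / a] G = 0 := by
    obtain ⟨x, y, z, hxyz⟩ := exists_psiB3_eq ha hb hc
    rw [← hxyz, h]
  have hext (t t' : Fin 6 →₀ ℕ) (h0 : t 0 = t' 0) (h1 : t 1 = t' 1) (h2 : t 2 = t' 2)
      (h3 : t 3 = t' 3) (h4 : t 4 = t' 4) (h5 : t 5 = t' 5) : t = t' := by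
    ext i
    fin_cases i <;> assumption
  have hsum (a b c : ℂ) (ha : a ≠ 0) (hb : b ≠ 0) (hc : c ≠ 0) :
      ∑ t ∈ G.support, coeff t G * (a ^ t 0 * b ^ t 1 * c ^ t 2 * ((a ^ 2 - b ^ 2) / c) ^ t 3 *
        ((a ^ 2 - c ^ 2) / b) ^ t 4 * ((b ^ 2 - c ^ 2) / a) ^ t 5) = 0 := by
    simpa [eval_eq', Fin.prod_univ_six] using hgraph a b c ha hb hc
  have h3 : ∀ t ∈ G.support, coeff t G ≠ 0 → t 3 = 0 := by
    refine coeff_eq_zero_of_pole G.support (coeff · G) (· 0) (· 1) (· 2) (· 3) (· 4) (· 5)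
      ?_ ?_ ?_ ?_ ?_ hsum
    · exact fun t ht => (hG t ht).1
    · exact fun t ht => (hG t ht).2.1
    · exact fun t ht => (hG t ht).2.2.1
    · exact fun t ht => (hG t ht).2.2.2
    · exact fun t _ t' _ => hext t t'
  have h4 : ∀ t ∈ G.support, (-1) ^ t 5 * coeff t G ≠ 0 → t 4 = 0 := by
    refine coeff_eq_zero_of_pole G.support (fun t => (-1) ^ t 5 * coeff t G)
      (· 0) (· 2) (· 1) (· 4) (· 3) (· 5) ?_ ?_ ?_ ?_ ?_ ?_
    · exact fun t ht => (hG t ht).1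
    · exact fun t ht => (hG t ht).2.2.1
    · exact fun t ht => (hG t ht).2.1
    · exact fun t ht => by have := (hG t ht).2.2.2; tauto
    · exact fun t _ t' _ e0 e2 e1 e4 e3 e5 => hext t t' e0 e1 e2 e3 e4 e5
    · intro a b c ha hb hc
      rw [← hsum a c b ha hc hb]
      refine Finset.sum_congr rfl fun t _ => ?_
      rw [show (c ^ 2 - b ^ 2) / a = -1 * ((b ^ 2 - c ^ 2) / a) by ring, mul_pow (-1 : ℂ)]
      ring
  have h5 : ∀ t ∈ G.support, (-1) ^ (t 3 + t 4) * coeff t G ≠ 0 → t 5 = 0 := by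
    refine coeff_eq_zero_of_pole G.support (fun t => (-1) ^ (t 3 + t 4) * coeff t G)
      (· 1) (· 2) (· 0) (· 5) (· 3) (· 4) ?_ ?_ ?_ ?_ ?_ ?_
    · exact fun t ht => (hG t ht).2.1
    · exact fun t ht => (hG t ht).2.2.1
    · exact fun t ht => (hG t ht).1
    · exact fun t ht => by have := (hG t ht).2.2.2; tauto
    · exact fun t _ t' _ e1 e2 e0 e5 e3 e4 => hext t t' e0 e1 e2 e3 e4 e5
    · intro a b c ha hb hc
      rw [← hsum c a b hc ha hb]
      refine Finset.sum_congr rfl fun t _ => ?_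
      rw [show (c ^ 2 - b ^ 2) / a = -1 * ((b ^ 2 - c ^ 2) / a) by ring,
        show (c ^ 2 - a ^ 2) / b = -1 * ((a ^ 2 - c ^ 2) / b) by ring, mul_pow (-1 : ℂ),
        mul_pow (-1 : ℂ), pow_add]
      ring
  have hzero : ∀ t ∈ G.support, t 3 = 0 ∧ t 4 = 0 ∧ t 5 = 0 := fun t ht =>
    have hw := mem_support_iff.1 ht
    ⟨h3 t ht hw, h4 t ht (mul_ne_zero (by simp) hw), h5 t ht (mul_ne_zero (by simp) hw)⟩
  have hprod : X 0 * X 1 * X 2 * G = 0 := by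
    refine MvPolynomial.funext fun u => ?_
    simp only [map_mul, eval_X, map_zero]
    by_cases hu : u 0 * u 1 * u 2 = 0
    · rw [hu, zero_mul]
    · have hu' : (u 0 ≠ 0 ∧ u 1 ≠ 0) ∧ u 2 ≠ 0 := by
        simpa only [mul_ne_zero_iff] using (show _ ≠ _ from hu)
      rw [eval_eq', ← mul_zero (u 0 * u 1 * u 2),
        ← hsum (u 0) (u 1) (u 2) hu'.1.1 hu'.1.2 hu'.2]
      congr 1
      refine Finset.sum_congr rfl fun t ht => ?_
      obtain ⟨e3, e4, e5⟩ := hzero t ht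
      simp [Fin.prod_univ_six, e3, e4, e5]
  exact (mul_eq_zero.1 hprod).resolve_left
    (mul_ne_zero (mul_ne_zero (X_ne_zero 0) (X_ne_zero 1)) (X_ne_zero 2))

end B3Surface

/-- The vanishing ideal of the image of ψ : ℂ³ → ℂ⁶, i.e. the homogeneous ideal
of the affine cone over the B₃ surface X_{B₃} ⊂ ℙ⁵, is generated by
u₁² − u₂² − u₀u₅, u₀² − u₂² − u₁u₄, u₂u₃ − u₁u₄ + u₀u₅ and
u₀u₁u₃ − u₀u₂u₄ + u₁u₂u₅ − u₃u₄u₅. -/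
theorem b3_surface_ideal (F : MvPolynomial (Fin 6) ℂ) :
    (∀ x y z : ℂ, eval (psiB3 x y z) F = 0) ↔
      F ∈ Ideal.span
        ({X 1 ^ 2 - X 2 ^ 2 - X 0 * X 5,
          X 0 ^ 2 - X 2 ^ 2 - X 1 * X 4,
          X 2 * X 3 - X 1 * X 4 + X 0 * X 5,
          X 0 * X 1 * X 3 - X 0 * X 2 * X 4 + X 1 * X 2 * X 5 - X 3 * X 4 * X 5} :
          Set (MvPolynomial (Fin 6) ℂ)) := by
  refine ⟨fun h => ?_, fun h => B3Surface.eval_psiB3_of_mem_equations h⟩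
  obtain ⟨E, hE, G, hG, rfl⟩ := Submodule.mem_sup.1 (B3Surface.mem_reducible F)
  have hE : E ∈ B3Surface.equations := hE
  have hG0 : G = 0 := by
    refine B3Surface.eq_zero_of_isStandard (fun t ht => (mem_restrictSupport_iff ℂ).1 hG ht)
      fun x y z => ?_
    simpa [B3Surface.eval_psiB3_of_mem_equations hE] using h x y z
  rw [hG0, add_zero]
  exact hE
end
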